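/- Suppose |C^{ij}| ≤ ρ for all i ∈ 𝓢 and j ∉ 𝓢 (partial orthogonality). Let θ₀ ∈ ℝ^p with θ₀^j = 0 for j ∉ 𝓢 and θ₀^j ≠ 0 for j ∈ 𝓢; set η₀ := Cθ₀ and assume η₀^j ≠ 0 for every j ∈ 𝓢. Define u ∈ ℝ^s by u^j := sign(θ₀^j)/|η₀^j| and 𝔠 := (max_{j∉𝓢} |η₀^j|) · (Σ_{j∈𝓢} 1/(s |η₀^j|²))^{1/2}. If 𝔠 ≤ κ τ / (s ρ), then for every j ∈ {1,…,p−s}: |η₀^{j+s}| · |(C^{𝓢ᶜ𝓢} (C^{𝓢𝓢})⁻¹ u)^j| ≤ κ, i.e. the adaptive irrepresentable condition of Assumption (B₂) holds with constant κ. (The deterministic part of Theorem 3.3: partial orthogonality implies the adaptive irrepresentable condition.) -/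

import Mathlib

open MeasureTheory Matrix Finset

/-- Euclidean (ℓ₂) norm of a vector in ℝⁿ. -/
noncomputable def l2norm {n : ℕ} (v : Fin n → ℝ) : ℝ := Real.sqrt (∑ i, v i ^ 2)

/-- Operator norm of a matrix, induced by the Euclidean norms. -/
noncomputable def opNorm {m n : ℕ} (A : Matrix (Fin m) (Fin n) ℝ) : ℝ :=
  ‖(Matrix.toEuclideanLin A).toContinuousLinearMap‖

/-- The s×s submatrix `C^{𝓢𝓢}` with rows and columns indexed by `𝓢 = {1,…,s}`. -/
def subSS {p : ℕ} (s : ℕ) (h : s ≤ p) (A : Matrix (Fin p) (Fin p) ℝ) :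
    Matrix (Fin s) (Fin s) ℝ :=
  A.submatrix (Fin.castLE h) (Fin.castLE h)

/-- The embedding of `𝓢ᶜ = {s+1,…,p}` into `{1,…,p}`. -/
def embSc {p s : ℕ} (j : Fin (p - s)) : Fin p :=
  ⟨s + j.1, by have := j.isLt; omega⟩

/-- The (p−s)×s submatrix `C^{𝓢ᶜ𝓢}` with rows indexed by `𝓢ᶜ` and columns by `𝓢`. -/
def subScS {p : ℕ} (s : ℕ) (h : s ≤ p) (A : Matrix (Fin p) (Fin p) ℝ) :
    Matrix (Fin (p - s)) (Fin s) ℝ :=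
  Matrix.of fun j i => A (embSc j) (Fin.castLE h i)

theorem l2norm_nonneg {n : ℕ} (v : Fin n → ℝ) : 0 ≤ l2norm v := Real.sqrt_nonneg _

theorem l2norm_sq {n : ℕ} (v : Fin n → ℝ) : l2norm v ^ 2 = ∑ i, v i ^ 2 :=
  Real.sq_sqrt (Finset.sum_nonneg fun i _ => sq_nonneg (v i))

theorem l2norm_eq_zero {n : ℕ} {v : Fin n → ℝ} (h : l2norm v = 0) : v = 0 := by
  have hsum : ∑ i, v i ^ 2 = 0 := by rw [← l2norm_sq, h]; norm_num
  funext i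
  have := (Finset.sum_eq_zero_iff_of_nonneg fun i _ => sq_nonneg (v i)).1 hsum i
    (Finset.mem_univ i)
  simpa using this

theorem l2norm_smul {n : ℕ} (a : ℝ) (v : Fin n → ℝ) : l2norm (a • v) = |a| * l2norm v := by
  simp only [l2norm, Pi.smul_apply, smul_eq_mul, mul_pow, ← Finset.mul_sum]
  rw [Real.sqrt_mul (sq_nonneg a), Real.sqrt_sq_eq_abs]

theorem abs_dotProduct_le_l2norm_mul_l2norm {n : ℕ} (v w : Fin n → ℝ) :
    |v ⬝ᵥ w| ≤ l2norm v * l2norm w := by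
  refine abs_le_of_sq_le_sq ?_ (mul_nonneg (l2norm_nonneg v) (l2norm_nonneg w))
  rw [mul_pow, l2norm_sq, l2norm_sq]
  exact Finset.sum_mul_sq_le_sq_mul_sq _ _ _

theorem l2norm_le_sqrt_mul {n : ℕ} {v : Fin n → ℝ} {ρ : ℝ} (hρ : 0 ≤ ρ)
    (h : ∀ i, |v i| ≤ ρ) : l2norm v ≤ √n * ρ := by
  refine Real.sqrt_le_iff.2 ⟨by positivity, ?_⟩
  rw [mul_pow, Real.sq_sqrt (Nat.cast_nonneg n)]
  calc ∑ i, v i ^ 2 ≤ ∑ _i : Fin n, ρ ^ 2 :=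
        Finset.sum_le_sum fun i _ => sq_le_sq.2 (by rw [abs_of_nonneg hρ]; exact h i)
    _ = n * ρ ^ 2 := by simp

/-- A lower bound of a quadratic form on the unit sphere extends to all vectors. -/
theorem mul_l2norm_sq_le_dotProduct_mulVec {n : ℕ} {A : Matrix (Fin n) (Fin n) ℝ} {τ : ℝ}
    (h : ∀ v, l2norm v = 1 → τ ≤ v ⬝ᵥ (A *ᵥ v)) (v : Fin n → ℝ) :
    τ * l2norm v ^ 2 ≤ v ⬝ᵥ (A *ᵥ v) := by
  rcases eq_or_ne (l2norm v) 0 with h0 | h0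
  · rw [h0, l2norm_eq_zero h0]; simp
  have h1 := h ((l2norm v)⁻¹ • v) (by
    rw [l2norm_smul, abs_of_nonneg (inv_nonneg.2 (l2norm_nonneg v)), inv_mul_cancel₀ h0])
  rw [mulVec_smul, smul_dotProduct, dotProduct_smul, smul_eq_mul, smul_eq_mul] at h1
  calc τ * l2norm v ^ 2
      ≤ ((l2norm v)⁻¹ * ((l2norm v)⁻¹ * (v ⬝ᵥ (A *ᵥ v)))) * l2norm v ^ 2 := by gcongr
    _ = v ⬝ᵥ (A *ᵥ v) := by field_simp

theorem mul_l2norm_le_l2norm_mulVec {n : ℕ} {A : Matrix (Fin n) (Fin n) ℝ} {τ : ℝ}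
    (h : ∀ v, l2norm v = 1 → τ ≤ v ⬝ᵥ (A *ᵥ v)) (v : Fin n → ℝ) :
    τ * l2norm v ≤ l2norm (A *ᵥ v) := by
  rcases (l2norm_nonneg v).eq_or_lt with h0 | h0
  · rw [← h0, mul_zero]; exact l2norm_nonneg _
  refine le_of_mul_le_mul_left ?_ h0
  calc l2norm v * (τ * l2norm v) = τ * l2norm v ^ 2 := by ring
    _ ≤ v ⬝ᵥ (A *ᵥ v) := mul_l2norm_sq_le_dotProduct_mulVec h v
    _ ≤ l2norm v * l2norm (A *ᵥ v) :=
        (le_abs_self _).trans (abs_dotProduct_le_l2norm_mul_l2norm _ _)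

theorem isUnit_det_of_le_dotProduct_mulVec {n : ℕ} {A : Matrix (Fin n) (Fin n) ℝ} {τ : ℝ}
    (hτ : 0 < τ) (h : ∀ v, l2norm v = 1 → τ ≤ v ⬝ᵥ (A *ᵥ v)) : IsUnit A.det := by
  rw [isUnit_iff_ne_zero]
  intro hdet
  obtain ⟨v, hv, hAv⟩ := Matrix.exists_mulVec_eq_zero_iff.2 hdet
  have hle := mul_l2norm_le_l2norm_mulVec h v
  rw [hAv, show l2norm (0 : Fin n → ℝ) = 0 by simp [l2norm]] at hle
  exact hv (l2norm_eq_zero (le_antisymm (nonpos_of_mul_nonpos_right hle hτ) (l2norm_nonneg v)))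

theorem sq_sign_le_one (x : ℝ) : Real.sign x ^ 2 ≤ 1 := by
  rcases Real.sign_apply_eq x with h | h | h <;> rw [h] <;> norm_num

/-- deterministic part of Theorem 3.3.
Partial orthogonality (`|C^{ij}| ≤ ρ` for `i ∈ 𝓢`, `j ∉ 𝓢`) together with
`𝔠 ≤ κ τ / (s ρ)` implies the adaptive irrepresentable condition:
for every `j ∈ {1,…,p−s}`, `|η₀^{j+s}| |(C^{𝓢ᶜ𝓢}(C^{𝓢𝓢})⁻¹ u)^j| ≤ κ`. -/
theorem partial_orthogonality_implies_irrepresentable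
    (p s : ℕ) (hs1 : 1 ≤ s) (hsp : s < p)
    (C : Matrix (Fin p) (Fin p) ℝ) (hCsymm : C.IsSymm)
    (τ : ℝ) (hτpos : 0 < τ)
    (hτ : IsLeast {r : ℝ | ∃ v : Fin s → ℝ, l2norm v = 1 ∧
      v ⬝ᵥ (subSS s hsp.le C *ᵥ v) = r} τ)
    (ρ κ : ℝ) (hρ : 0 < ρ) (hκ0 : 0 ≤ κ) (hκ1 : κ ≤ 1)
    (hPO : ∀ i j : Fin p, (i : ℕ) < s → s ≤ (j : ℕ) → |C i j| ≤ ρ)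
    (θ0 : Fin p → ℝ)
    (hθ0S : ∀ j : Fin p, (j : ℕ) < s → θ0 j ≠ 0)
    (hθ0Sc : ∀ j : Fin p, s ≤ (j : ℕ) → θ0 j = 0)
    (η0 : Fin p → ℝ) (hη0 : η0 = C *ᵥ θ0)
    (hη0S : ∀ j : Fin p, (j : ℕ) < s → η0 j ≠ 0)
    (u : Fin s → ℝ)
    (hu : ∀ j : Fin s, u j =
      Real.sign (θ0 (Fin.castLE hsp.le j)) / |η0 (Fin.castLE hsp.le j)|)
    (m c : ℝ)
    (hm : IsGreatest {r : ℝ | ∃ j : Fin (p - s), r = |η0 (embSc j)|} m)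
    (hc : c = m * Real.sqrt (∑ j : Fin s, 1 / ((s : ℝ) * |η0 (Fin.castLE hsp.le j)| ^ 2)))
    (hcond : c ≤ κ * τ / ((s : ℝ) * ρ)) :
    ∀ j : Fin (p - s),
      |η0 (embSc j)| * |((subScS s hsp.le C * (subSS s hsp.le C)⁻¹) *ᵥ u) j| ≤ κ := by
  intro j
  set A := subSS s hsp.le C
  have hA : ∀ v, l2norm v = 1 → τ ≤ v ⬝ᵥ (A *ᵥ v) := fun v hv => hτ.2 ⟨v, hv, rfl⟩
  have hs : (0 : ℝ) < s := by exact_mod_cast hs1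
  set S := √(∑ j : Fin s, 1 / ((s : ℝ) * |η0 (Fin.castLE hsp.le j)| ^ 2)) with hS
  have hu_le : l2norm u ≤ √s * S := by
    rw [hS, ← Real.sqrt_mul hs.le, Finset.mul_sum]
    refine Real.sqrt_le_sqrt (Finset.sum_le_sum fun i _ => ?_)
    have hpos : 0 < |η0 (Fin.castLE hsp.le i)| := abs_pos.2 (hη0S _ i.isLt)
    calc u i ^ 2 = Real.sign (θ0 (Fin.castLE hsp.le i)) ^ 2 / |η0 (Fin.castLE hsp.le i)| ^ 2 := by
          rw [hu, div_pow]
      _ ≤ 1 / |η0 (Fin.castLE hsp.le i)| ^ 2 := by gcongr; exact sq_sign_le_one _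
      _ = s * (1 / (s * |η0 (Fin.castLE hsp.le i)| ^ 2)) := by field_simp
  set w := A⁻¹ *ᵥ u with hw
  have hAw : A *ᵥ w = u := by
    rw [hw, mulVec_mulVec, mul_nonsing_inv A (isUnit_det_of_le_dotProduct_mulVec hτpos hA),
      one_mulVec]
  have hw_le : l2norm w ≤ √s * S / τ := by
    rw [le_div_iff₀' hτpos]
    exact (hAw ▸ mul_l2norm_le_l2norm_mulVec hA w).trans hu_le
  have hrow : l2norm (subScS s hsp.le C j) ≤ √s * ρ := by
    refine l2norm_le_sqrt_mul hρ.le fun i => ?_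
    change |C (embSc j) (Fin.castLE hsp.le i)| ≤ ρ
    rw [← hCsymm.apply]
    exact hPO _ _ i.isLt (Nat.le_add_right s j)
  have hm_le : |η0 (embSc j)| ≤ m := hm.2 ⟨j, rfl⟩
  have hm0 : 0 ≤ m := (abs_nonneg _).trans hm_le
  rw [← mulVec_mulVec, ← hw]
  calc |η0 (embSc j)| * |(subScS s hsp.le C *ᵥ w) j|
      ≤ m * ((√s * ρ) * (√s * S / τ)) := by
        gcongr
        exact (abs_dotProduct_le_l2norm_mul_l2norm _ _).trans
          (mul_le_mul hrow hw_le (l2norm_nonneg w) (by positivity))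
    _ = (√s * √s) * ρ * c / τ := by rw [hc]; ring
    _ = s * ρ * c / τ := by rw [Real.mul_self_sqrt hs.le]
    _ ≤ s * ρ * (κ * τ / (s * ρ)) / τ := by gcongr
    _ = κ := by field_simp
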